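/- For the Lamb–Oseen azimuthal profile $u^{LO}_\theta(t,r) = \frac{1}{2\pi r}(1 - e^{-r^2/(4(1+t))})$, there exists a constant $C > 0$ such that for all $0 \leq t_1 \leq t_2$, $\int_0^\infty |u^{LO}_\theta(t_2,r) - u^{LO}_\theta(t_1,r)|^2 \, r\,dr \leq C \ln\big(\frac{1+t_2}{1+t_1}\big)$. -/

import Mathlib

open Real MeasureTheory

/-- Azimuthal component of the Lamb–Oseen velocity field. -/
noncomputable def uLO (t r : ℝ) : ℝ :=
  (1 / (2 * π * r)) * (1 - Real.exp (-r ^ 2 / (4 * (1 + t))))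

open Filter Topology

/-- A Gaussian difference divided by the radius is dominated by a first Gaussian moment. -/
lemma inv_mul_gaussian_sub_le {a b x : ℝ} (hx : 0 < x) :
    x⁻¹ * (exp (-(b * x) ^ 2) - exp (-(a * x) ^ 2))
      ≤ (a ^ 2 - b ^ 2) * (x * exp (-b ^ 2 * x ^ 2)) := by
  have h₁ := add_one_le_exp (-((a ^ 2 - b ^ 2) * x ^ 2))
  have h₂ : exp (-(a * x) ^ 2) = exp (-b ^ 2 * x ^ 2) * exp (-((a ^ 2 - b ^ 2) * x ^ 2)) := by
    rw [← exp_add]; ring_nf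
  have h₃ : exp (-(b * x) ^ 2) = exp (-b ^ 2 * x ^ 2) := by ring_nf
  rw [h₂, h₃, inv_mul_le_iff₀ hx]
  nlinarith [mul_le_mul_of_nonneg_left h₁ (exp_pos (-b ^ 2 * x ^ 2)).le]

lemma gaussian_sub_nonneg {a b x : ℝ} (hb : 0 ≤ b) (hab : b ≤ a) (hx : 0 < x) :
    0 ≤ exp (-(b * x) ^ 2) - exp (-(a * x) ^ 2) := by
  rw [sub_nonneg, exp_le_exp, neg_le_neg_iff]
  gcongr

lemma integrableOn_inv_mul_gaussian_sub {a b : ℝ} (hb : 0 < b) (hab : b ≤ a) :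
    IntegrableOn (fun x ↦ x⁻¹ * (exp (-(b * x) ^ 2) - exp (-(a * x) ^ 2))) (Set.Ioi 0) := by
  refine Integrable.mono'
    ((integrable_mul_exp_neg_mul_sq (pow_pos hb 2)).const_mul (a ^ 2 - b ^ 2)).integrableOn
    (Measurable.aestronglyMeasurable (by fun_prop)) ?_
  filter_upwards [ae_restrict_mem measurableSet_Ioi] with x hx
  rw [norm_of_nonneg (mul_nonneg (inv_nonneg.2 (le_of_lt hx)) (gaussian_sub_nonneg hb.le hab hx))]
  exact inv_mul_gaussian_sub_le hx

lemma integral_inv_mul_gaussian_sub {a b : ℝ} (hb : 0 < b) (hab : b ≤ a) :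
    ∫ x in Set.Ioi (0 : ℝ), x⁻¹ * (exp (-(b * x) ^ 2) - exp (-(a * x) ^ 2)) = log (a / b) := by
  have hcont : Continuous fun x : ℝ ↦ exp (-x ^ 2) := by fun_prop
  have hL : Tendsto (fun x : ℝ ↦ exp (-x ^ 2)) (𝓝[>] 0) (𝓝 1) := by
    simpa using (hcont.tendsto 0).mono_left nhdsWithin_le_nhds
  have hR : Tendsto (fun x : ℝ ↦ exp (-x ^ 2)) atTop (𝓝 0) :=
    tendsto_exp_neg_atTop_nhds_zero.comp (tendsto_pow_atTop two_ne_zero)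
  simpa using Frullani.integral_Ioi_eq (hcont.locallyIntegrable.locallyIntegrableOn _)
    hb (hb.trans_le hab) hL hR (integrableOn_inv_mul_gaussian_sub hb hab)

lemma uLO_eq_inv_two_sqrt {t : ℝ} (ht : 0 ≤ t) (r : ℝ) :
    uLO t r = (1 / (2 * π * r)) * (1 - exp (-((2 * √(1 + t))⁻¹ * r) ^ 2)) := by
  have h : -r ^ 2 / (4 * (1 + t)) = -((2 * √(1 + t))⁻¹ * r) ^ 2 := by
    rw [mul_pow, inv_pow, mul_pow, sq_sqrt (by linarith)]
    field_simp
    norm_num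
  rw [uLO, h]

/-- The energy density of a difference of profiles is bounded by a Frullani integrand, because
a difference of Gaussians lies in `[0, 1]`. -/
lemma abs_uLO_sub_sq_mul_le {t₁ t₂ r : ℝ} (h₁ : 0 ≤ t₁) (h₁₂ : t₁ ≤ t₂) (hr : 0 < r) :
    |uLO t₂ r - uLO t₁ r| ^ 2 * r ≤ 1 / (4 * π ^ 2) *
      (r⁻¹ * (exp (-((2 * √(1 + t₂))⁻¹ * r) ^ 2) - exp (-((2 * √(1 + t₁))⁻¹ * r) ^ 2))) := by
  rw [uLO_eq_inv_two_sqrt h₁, uLO_eq_inv_two_sqrt (h₁.trans h₁₂), sq_abs]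
  have hs : 0 < √(1 + t₁) := sqrt_pos.2 (by linarith)
  have hE := gaussian_sub_nonneg (b := (2 * √(1 + t₂))⁻¹) (a := (2 * √(1 + t₁))⁻¹)
    (by positivity) (by gcongr) hr
  have h₃ : exp (-((2 * √(1 + t₂))⁻¹ * r) ^ 2) ≤ 1 := exp_le_one_iff.2 (by nlinarith)
  have h₄ := exp_pos (-((2 * √(1 + t₁))⁻¹ * r) ^ 2)
  generalize exp (-((2 * √(1 + t₂))⁻¹ * r) ^ 2) = x at *
  generalize exp (-((2 * √(1 + t₁))⁻¹ * r) ^ 2) = y at *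
  calc (1 / (2 * π * r) * (1 - x) - 1 / (2 * π * r) * (1 - y)) ^ 2 * r
      = 1 / (4 * π ^ 2) * (r⁻¹ * (x - y) ^ 2) := by field_simp; ring
    _ ≤ 1 / (4 * π ^ 2) * (r⁻¹ * (x - y)) := by
      gcongr
      nlinarith

theorem oseen_L2_difference_log_bound :
    ∃ C : ℝ, 0 < C ∧ ∀ t₁ t₂ : ℝ, 0 ≤ t₁ → t₁ ≤ t₂ →
      (∫ r in Set.Ioi (0 : ℝ), |uLO t₂ r - uLO t₁ r| ^ 2 * r)
        ≤ C * Real.log ((1 + t₂) / (1 + t₁)) := by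
  refine ⟨1 / (8 * π ^ 2), by positivity, fun t₁ t₂ h₁ h₁₂ ↦ ?_⟩
  have hs₁ : 0 < √(1 + t₁) := sqrt_pos.2 (by linarith)
  have hs₂ : 0 < √(1 + t₂) := sqrt_pos.2 (by linarith)
  have hb : 0 < (2 * √(1 + t₂))⁻¹ := by positivity
  have hab : (2 * √(1 + t₂))⁻¹ ≤ (2 * √(1 + t₁))⁻¹ := by gcongr
  have hlog : log ((2 * √(1 + t₁))⁻¹ / (2 * √(1 + t₂))⁻¹) = log ((1 + t₂) / (1 + t₁)) / 2 := by
    rw [← log_sqrt (div_nonneg (by linarith) (by linarith)), sqrt_div (by linarith)]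
    congr 1
    field_simp
  calc ∫ r in Set.Ioi (0 : ℝ), |uLO t₂ r - uLO t₁ r| ^ 2 * r
      ≤ ∫ r in Set.Ioi (0 : ℝ), 1 / (4 * π ^ 2) * (r⁻¹ *
          (exp (-((2 * √(1 + t₂))⁻¹ * r) ^ 2) - exp (-((2 * √(1 + t₁))⁻¹ * r) ^ 2))) := by
        refine integral_mono_of_nonneg ?_
          ((integrableOn_inv_mul_gaussian_sub hb hab).const_mul _) ?_
        · filter_upwards [ae_restrict_mem measurableSet_Ioi] with r hr
          exact mul_nonneg (sq_nonneg _) (le_of_lt hr)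
        · filter_upwards [ae_restrict_mem measurableSet_Ioi] with r hr
          exact abs_uLO_sub_sq_mul_le h₁ h₁₂ hr
    _ = 1 / (8 * π ^ 2) * log ((1 + t₂) / (1 + t₁)) := by
        rw [integral_const_mul, integral_inv_mul_gaussian_sub hb hab, hlog]
        ring
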